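/- arXiv:2108.09777 — 2 statements merged into one kernel-verified Lean document; each statement's English description precedes it below -/
import Mathlib

section
/- (Theorem 1(c)) In the system obtained from GPFL= over the language extended with the binary quantifier I by adding as additional initial sequents all instances of (SI2) with G replaced by ∃!, i.e. Ix[F,∃!x], Ix[F,∃!x] ⇒ ∃y(∀x(F↔x=y)∧∃!y) (y a variable not occurring in F), both of the following rules are admissible: (LI²'): whenever Γ⇒Δ,F[t₁/x]; Γ⇒Δ,F[t₂/x]; Γ⇒Δ,∃!t₁; and Γ⇒Δ,∃!t₂ are provable, so is Ix[F,∃!x],Γ⇒Δ,t₁=t₂; and (LI³): whenever F[a/x],∃!a,Γ⇒Δ is provable with parameter a not occurring in Γ, Δ, or F, so is Ix[F,∃!x],Γ⇒Δ. -/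
/-!
Deep embedding of the language of classical positive free logic with the
binary quantifier `I` for definite descriptions (`Ix[F,G]`, "the F is G"),
and of Indrzejczak's sequent calculus GPFL= extended by the rules for `I`
(the system GPFL=^I of Kürbis).  Bound variables are de Bruijn indices,
free variables are "parameters" (natural numbers).
-/

/-- A first-order signature: function symbols and predicate symbols with arities. -/
structure Sig where
  Fn : Type
  fnAr : Fn → ℕ
  Pr : Type
  prAr : Pr → ℕ

/-- Terms: parameters, constants, (de Bruijn) bound variables and function terms. -/
inductive Tm (σ : Sig) : Type
  | par : ℕ → Tm σ
  | const : ℕ → Tm σ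
  | bvar : ℕ → Tm σ
  | func : (f : σ.Fn) → (Fin (σ.fnAr f) → Tm σ) → Tm σ

namespace Tm

variable {σ : Sig}

/-- Lift (shift up by one) the bound variables `≥ c`. -/
def lift (c : ℕ) : Tm σ → Tm σ
  | par a => par a
  | const k => const k
  | bvar n => if n < c then bvar n else bvar (n + 1)
  | func f ts => func f fun i => (ts i).lift c

/-- Substitute the term `u` for the bound variable `k`. -/
def inst (k : ℕ) (u : Tm σ) : Tm σ → Tm σ
  | par a => par a
  | const c => const c
  | bvar n => if n = k then u else if k < n then bvar (n - 1) else bvar n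
  | func f ts => func f fun i => inst k u (ts i)

/-- Substitute the term `u` for the parameter `a`. -/
def substPar (a : ℕ) (u : Tm σ) : Tm σ → Tm σ
  | par b => if b = a then u else par b
  | const c => const c
  | bvar n => bvar n
  | func f ts => func f fun i => substPar a u (ts i)

/-- The set of parameters occurring in a term. -/
def pars : Tm σ → Set ℕ
  | par a => {a}
  | const _ => ∅
  | bvar _ => ∅
  | func _ ts => ⋃ i, (ts i).pars

/-- A term is `ClosedB` if it contains no (dangling) bound variables; genuine
terms of the language are of this kind, and such a term is automatically
free for any variable in any formula. -/
def ClosedB : Tm σ → Prop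
  | par _ => True
  | const _ => True
  | bvar _ => False
  | func _ ts => ∀ i, (ts i).ClosedB

end Tm

/-- Formulas, including the existence predicate `ext t` (`∃!t`) and the binary
quantifier `iq F G` (`Ix[F,G]`), which binds the de Bruijn variable `0` in
both `F` and `G`. -/
inductive Fml (σ : Sig) : Type
  | atom : (p : σ.Pr) → (Fin (σ.prAr p) → Tm σ) → Fml σ
  | eq : Tm σ → Tm σ → Fml σ
  | ext : Tm σ → Fml σ
  | neg : Fml σ → Fml σ
  | conj : Fml σ → Fml σ → Fml σ
  | disj : Fml σ → Fml σ → Fml σ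
  | imp : Fml σ → Fml σ → Fml σ
  | all : Fml σ → Fml σ
  | ex : Fml σ → Fml σ
  | iq : Fml σ → Fml σ → Fml σ

namespace Fml

variable {σ : Sig}

/-- Lift (shift up by one) the bound variables `≥ c`. -/
def lift (c : ℕ) : Fml σ → Fml σ
  | atom p ts => atom p fun i => (ts i).lift c
  | eq t s => eq (t.lift c) (s.lift c)
  | ext t => ext (t.lift c)
  | neg A => neg (A.lift c)
  | conj A B => conj (A.lift c) (B.lift c)
  | disj A B => disj (A.lift c) (B.lift c)
  | imp A B => imp (A.lift c) (B.lift c)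
  | all A => all (A.lift (c + 1))
  | ex A => ex (A.lift (c + 1))
  | iq F G => iq (F.lift (c + 1)) (G.lift (c + 1))

/-- Substitute the term `u` for the bound variable `k`. -/
def inst (k : ℕ) (u : Tm σ) : Fml σ → Fml σ
  | atom p ts => atom p fun i => Tm.inst k u (ts i)
  | eq t s => eq (Tm.inst k u t) (Tm.inst k u s)
  | ext t => ext (Tm.inst k u t)
  | neg A => neg (A.inst k u)
  | conj A B => conj (A.inst k u) (B.inst k u)
  | disj A B => disj (A.inst k u) (B.inst k u)
  | imp A B => imp (A.inst k u) (B.inst k u)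
  | all A => all (A.inst (k + 1) (u.lift 0))
  | ex A => ex (A.inst (k + 1) (u.lift 0))
  | iq F G => iq (F.inst (k + 1) (u.lift 0)) (G.inst (k + 1) (u.lift 0))

/-- `A.inst0 t` is `A[t/x]`: the result of substituting `t` for the
outermost bound variable `x` (de Bruijn index 0) of `A`. -/
def inst0 (A : Fml σ) (u : Tm σ) : Fml σ := A.inst 0 u

/-- Substitute the term `u` for the parameter `a`. -/
def substPar (a : ℕ) (u : Tm σ) : Fml σ → Fml σ
  | atom p ts => atom p fun i => Tm.substPar a u (ts i)
  | eq t s => eq (Tm.substPar a u t) (Tm.substPar a u s)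
  | ext t => ext (Tm.substPar a u t)
  | neg A => neg (A.substPar a u)
  | conj A B => conj (A.substPar a u) (B.substPar a u)
  | disj A B => disj (A.substPar a u) (B.substPar a u)
  | imp A B => imp (A.substPar a u) (B.substPar a u)
  | all A => all (A.substPar a u)
  | ex A => ex (A.substPar a u)
  | iq F G => iq (F.substPar a u) (G.substPar a u)

/-- The set of parameters occurring in a formula. -/
def pars : Fml σ → Set ℕ
  | atom _ ts => ⋃ i, (ts i).pars
  | eq t s => t.pars ∪ s.pars
  | ext t => t.pars
  | neg A => A.pars
  | conj A B => A.pars ∪ B.pars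
  | disj A B => A.pars ∪ B.pars
  | imp A B => A.pars ∪ B.pars
  | all A => A.pars
  | ex A => A.pars
  | iq F G => F.pars ∪ G.pars

/-- The degree of a formula: the number of logical operators occurring in it;
`∃!t` counts as atomic (degree 0). -/
def deg : Fml σ → ℕ
  | atom _ _ => 0
  | eq _ _ => 0
  | ext _ => 0
  | neg A => A.deg + 1
  | conj A B => A.deg + B.deg + 1
  | disj A B => A.deg + B.deg + 1
  | imp A B => A.deg + B.deg + 1
  | all A => A.deg + 1
  | ex A => A.deg + 1
  | iq F G => F.deg + G.deg + 1

/-- Atomic formulas: predications, identities and existence statements. -/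
def Atomic : Fml σ → Prop
  | atom _ _ => True
  | eq _ _ => True
  | ext _ => True
  | _ => False

/-- `A ↔ B` abbreviates `(A → B) ∧ (B → A)`. -/
def iff (A B : Fml σ) : Fml σ := conj (imp A B) (imp B A)

/-- The formula `∃!x` (with `x` the variable bound by the surrounding
binder), used as the second argument of `I` in `Ix[F, ∃!x]`. -/
def exG : Fml σ := ext (Tm.bvar 0)

end Fml

/-- The parameter `a` does not occur in any formula of `Γ`. -/
def FreshM {σ : Sig} (a : ℕ) (Γ : Multiset (Fml σ)) : Prop := ∀ B ∈ Γ, a ∉ B.pars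

/-- Derivability in the sequent calculus GPFL= (Indrzejczak's calculus for
classical positive free logic with identity) over the language extended with
the binary quantifier `I`, augmented by the additional initial sequents
given by `Init`.  There are no rules for `I`; `I`-formulas can enter proofs
only through `Init` (or axioms, weakening, etc.). -/
inductive DerB (σ : Sig) (Init : Multiset (Fml σ) → Multiset (Fml σ) → Prop) :
    Multiset (Fml σ) → Multiset (Fml σ) → Prop
  | ax (A : Fml σ) : DerB σ Init {A} {A}
  | initSeq {Γ Δ : Multiset (Fml σ)} : Init Γ Δ → DerB σ Init Γ Δ
  | cut {Γ Θ Δ Λ : Multiset (Fml σ)} (A : Fml σ) :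
      DerB σ Init Γ (A ::ₘ Θ) → DerB σ Init (A ::ₘ Δ) Λ →
      DerB σ Init (Γ + Δ) (Θ + Λ)
  | lw {Γ Δ : Multiset (Fml σ)} (A : Fml σ) :
      DerB σ Init Γ Δ → DerB σ Init (A ::ₘ Γ) Δ
  | rw {Γ Δ : Multiset (Fml σ)} (A : Fml σ) :
      DerB σ Init Γ Δ → DerB σ Init Γ (A ::ₘ Δ)
  | lc {Γ Δ : Multiset (Fml σ)} (A : Fml σ) :
      DerB σ Init (A ::ₘ A ::ₘ Γ) Δ → DerB σ Init (A ::ₘ Γ) Δ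
  | rc {Γ Δ : Multiset (Fml σ)} (A : Fml σ) :
      DerB σ Init Γ (A ::ₘ A ::ₘ Δ) → DerB σ Init Γ (A ::ₘ Δ)
  | lneg {Γ Δ : Multiset (Fml σ)} (A : Fml σ) :
      DerB σ Init Γ (A ::ₘ Δ) → DerB σ Init (A.neg ::ₘ Γ) Δ
  | rneg {Γ Δ : Multiset (Fml σ)} (A : Fml σ) :
      DerB σ Init (A ::ₘ Γ) Δ → DerB σ Init Γ (A.neg ::ₘ Δ)
  | land {Γ Δ : Multiset (Fml σ)} (A B : Fml σ) :
      DerB σ Init (A ::ₘ B ::ₘ Γ) Δ → DerB σ Init ((A.conj B) ::ₘ Γ) Δ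
  | rand {Γ Δ : Multiset (Fml σ)} (A B : Fml σ) :
      DerB σ Init Γ (A ::ₘ Δ) → DerB σ Init Γ (B ::ₘ Δ) →
      DerB σ Init Γ ((A.conj B) ::ₘ Δ)
  | lor {Γ Δ : Multiset (Fml σ)} (A B : Fml σ) :
      DerB σ Init (A ::ₘ Γ) Δ → DerB σ Init (B ::ₘ Γ) Δ →
      DerB σ Init ((A.disj B) ::ₘ Γ) Δ
  | ror {Γ Δ : Multiset (Fml σ)} (A B : Fml σ) :
      DerB σ Init Γ (A ::ₘ B ::ₘ Δ) → DerB σ Init Γ ((A.disj B) ::ₘ Δ)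
  | limp {Γ Δ : Multiset (Fml σ)} (A B : Fml σ) :
      DerB σ Init Γ (A ::ₘ Δ) → DerB σ Init (B ::ₘ Γ) Δ →
      DerB σ Init ((A.imp B) ::ₘ Γ) Δ
  | rimp {Γ Δ : Multiset (Fml σ)} (A B : Fml σ) :
      DerB σ Init (A ::ₘ Γ) (B ::ₘ Δ) → DerB σ Init Γ ((A.imp B) ::ₘ Δ)
  | lall {Γ Δ : Multiset (Fml σ)} (A : Fml σ) (t : Tm σ) :
      DerB σ Init ((A.inst0 t) ::ₘ Γ) Δ →
      DerB σ Init ((Fml.ext t) ::ₘ (Fml.all A) ::ₘ Γ) Δ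
  | rall {Γ Δ : Multiset (Fml σ)} (A : Fml σ) (a : ℕ) :
      FreshM a Γ → FreshM a Δ → a ∉ A.pars →
      DerB σ Init ((Fml.ext (.par a)) ::ₘ Γ) ((A.inst0 (.par a)) ::ₘ Δ) →
      DerB σ Init Γ ((Fml.all A) ::ₘ Δ)
  | lex {Γ Δ : Multiset (Fml σ)} (A : Fml σ) (a : ℕ) :
      FreshM a Γ → FreshM a Δ → a ∉ A.pars →
      DerB σ Init ((Fml.ext (.par a)) ::ₘ (A.inst0 (.par a)) ::ₘ Γ) Δ →
      DerB σ Init ((Fml.ex A) ::ₘ Γ) Δ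
  | rex {Γ Δ : Multiset (Fml σ)} (A : Fml σ) (t : Tm σ) :
      DerB σ Init Γ ((A.inst0 t) ::ₘ Δ) →
      DerB σ Init ((Fml.ext t) ::ₘ Γ) ((Fml.ex A) ::ₘ Δ)
  | eqI {Γ Δ : Multiset (Fml σ)} (A : Fml σ) (t₁ t₂ : Tm σ) :
      A.Atomic →
      DerB σ Init ((A.inst0 t₂) ::ₘ Γ) Δ →
      DerB σ Init ((Fml.eq t₁ t₂) ::ₘ (A.inst0 t₁) ::ₘ Γ) Δ
  | eqE {Γ Δ : Multiset (Fml σ)} (t : Tm σ) :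
      DerB σ Init ((Fml.eq t t) ::ₘ Γ) Δ → DerB σ Init Γ Δ

/-- The Russellian formula `∃y(∀x(F ↔ x = y) ∧ G[y/x])`, for formulas `F`,
`G` whose variable `x` is the de Bruijn index 0.  The variable `y` is the
one bound by the outer existential quantifier, so it does not occur in `F`
or `G`. -/
def SI1L {σ : Sig} (F G : Fml σ) : Fml σ :=
  Fml.ex (Fml.conj
    (Fml.all (Fml.iff (F.lift 1) (Fml.eq (.bvar 0) (.bvar 1)))) G)

/-- The initial sequents for Theorem 1(c): all instances of (SI2) with `G`
replaced by `∃!`: `Ix[F,∃!x], Ix[F,∃!x] ⇒ ∃y(∀x(F ↔ x = y) ∧ ∃!y)`. -/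
def Init7 (σ : Sig) : Multiset (Fml σ) → Multiset (Fml σ) → Prop :=
  fun Γ Δ =>
    ∃ F : Fml σ, Γ = {Fml.iq F Fml.exG, Fml.iq F Fml.exG} ∧ Δ = {SI1L F Fml.exG}

namespace Tm

variable {σ : Sig}

theorem inst_lift (k : ℕ) (u t : Tm σ) : inst k u (t.lift k) = t := by
  induction t with
  | par | const => rfl
  | bvar n =>
    by_cases h : n < k
    · simp [lift, inst, h, h.ne, h.le]
    · have h₁ : n + 1 ≠ k := by lia
      have h₂ : k < n + 1 := by lia
      simp [lift, inst, h, h₁, h₂]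
  | func f ts ih => simp [lift, inst, ih]

theorem pars_lift (k : ℕ) (t : Tm σ) : (t.lift k).pars = t.pars := by
  induction t with
  | par | const => rfl
  | bvar n => by_cases h : n < k <;> simp [lift, pars, h]
  | func f ts ih => simp [lift, pars, ih]

theorem finite_pars (t : Tm σ) : t.pars.Finite := by
  induction t with
  | par => exact Set.finite_singleton _
  | const | bvar => exact Set.finite_empty
  | func f ts ih => exact Set.finite_iUnion ih

end Tm

namespace Fml

variable {σ : Sig}

theorem inst_lift (k : ℕ) (u : Tm σ) (A : Fml σ) : (A.lift k).inst k u = A := by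
  induction A generalizing k u <;> simp_all [lift, inst, Tm.inst_lift]

theorem pars_lift (k : ℕ) (A : Fml σ) : (A.lift k).pars = A.pars := by
  induction A generalizing k <;> simp_all [lift, pars, Tm.pars_lift]

theorem finite_pars (A : Fml σ) : A.pars.Finite := by
  induction A with
  | atom p ts => exact Set.finite_iUnion fun i => (ts i).finite_pars
  | eq t s => exact t.finite_pars.union s.finite_pars
  | ext t => exact t.finite_pars
  | neg _ ih | all _ ih | ex _ ih => exact ih
  | conj _ _ ihA ihB | disj _ _ ihA ihB | imp _ _ ihA ihB | iq _ _ ihA ihB => exact ihA.union ihB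

/-- `∀x(F ↔ x = t)`, where `x` is the de Bruijn index 0 of `F`. -/
def uniq (F : Fml σ) (t : Tm σ) : Fml σ := all (iff F (eq (.bvar 0) (t.lift 0)))

end Fml

theorem FreshM.cons {σ : Sig} {a : ℕ} {A : Fml σ} {Γ : Multiset (Fml σ)}
    (hA : a ∉ A.pars) (hΓ : FreshM a Γ) : FreshM a (A ::ₘ Γ) := by
  simpa [FreshM] using ⟨hA, hΓ⟩

theorem finite_setOf_not_freshM {σ : Sig} (Γ : Multiset (Fml σ)) : {a | ¬ FreshM a Γ}.Finite := by
  refine (Γ.finite_toSet.biUnion fun A _ => A.finite_pars).subset fun a ha => ?_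
  simpa [FreshM] using ha

namespace DerB

variable {σ : Sig} {Init : Multiset (Fml σ) → Multiset (Fml σ) → Prop}
  {Γ Γ' Δ Δ' : Multiset (Fml σ)}

theorem add_left (Θ : Multiset (Fml σ)) (h : DerB σ Init Γ Δ) : DerB σ Init (Θ + Γ) Δ := by
  induction Θ using Multiset.induction with
  | empty => simpa using h
  | cons A Θ ih => simpa using ih.lw A

theorem add_right (Θ : Multiset (Fml σ)) (h : DerB σ Init Γ Δ) : DerB σ Init Γ (Θ + Δ) := by
  induction Θ using Multiset.induction with
  | empty => simpa using h
  | cons A Θ ih => simpa using ih.rw A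

theorem mono (h : DerB σ Init Γ Δ) (hΓ : Γ ≤ Γ') (hΔ : Δ ≤ Δ') : DerB σ Init Γ' Δ' := by
  obtain ⟨Θ, rfl⟩ := Multiset.le_iff_exists_add.1 hΓ
  obtain ⟨Λ, rfl⟩ := Multiset.le_iff_exists_add.1 hΔ
  simpa only [add_comm] using (h.add_left Θ).add_right Λ

theorem of_mem {A : Fml σ} (hΓ : A ∈ Γ) (hΔ : A ∈ Δ) : DerB σ Init Γ Δ :=
  (ax A).mono (by simpa using hΓ) (by simpa using hΔ)

theorem contract_left (Θ : Multiset (Fml σ)) (h : DerB σ Init (Θ + Θ + Γ) Δ) :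
    DerB σ Init (Θ + Γ) Δ := by
  induction Θ using Multiset.induction generalizing Γ with
  | empty => simpa using h
  | cons A Θ ih =>
    have h' : DerB σ Init (A ::ₘ A ::ₘ (Θ + Θ + Γ)) Δ := by simpa using h
    simpa using ih (Γ := A ::ₘ Γ) (by simpa using h'.lc)

theorem contract_right (Θ : Multiset (Fml σ)) (h : DerB σ Init Γ (Θ + Θ + Δ)) :
    DerB σ Init Γ (Θ + Δ) := by
  induction Θ using Multiset.induction generalizing Δ with
  | empty => simpa using h
  | cons A Θ ih =>
    have h' : DerB σ Init Γ (A ::ₘ A ::ₘ (Θ + Θ + Δ)) := by simpa using h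
    simpa using ih (Δ := A ::ₘ Δ) (by simpa using h'.rc)

theorem cut_shared {A : Fml σ} (h₁ : DerB σ Init Γ (A ::ₘ Δ)) (h₂ : DerB σ Init (A ::ₘ Γ) Δ) :
    DerB σ Init Γ Δ := by
  have h := cut A h₁ h₂
  simpa using contract_right (Δ := 0) Δ (by simpa using contract_left (Γ := 0) Γ (by simpa using h))

theorem iff_mp (A B : Fml σ) : DerB σ Init (A.iff B ::ₘ A ::ₘ Γ) (B ::ₘ Δ) := by
  refine land _ _ (limp _ _ ?_ ?_)
  · exact of_mem (A := A) (by simp) (by simp)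
  · exact of_mem (A := B) (by simp) (by simp)

theorem iff_mpr (A B : Fml σ) : DerB σ Init (A.iff B ::ₘ B ::ₘ Γ) (A ::ₘ Δ) := by
  refine land _ _ ?_
  rw [Multiset.cons_swap]
  refine limp _ _ ?_ ?_
  · exact of_mem (A := B) (by simp) (by simp)
  · exact of_mem (A := A) (by simp) (by simp)

theorem eq_of_uniq (F : Fml σ) (s t : Tm σ) :
    DerB σ Init (.ext s ::ₘ F.uniq t ::ₘ F.inst0 s ::ₘ Γ) (.eq s t ::ₘ Δ) := by
  refine lall _ _ ?_
  simpa [Fml.iff, Fml.inst0, Fml.inst, Tm.inst, Tm.inst_lift]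
    using iff_mp (Init := Init) (Γ := Γ) (Δ := Δ) (F.inst0 s) (.eq s t)

theorem of_uniq_of_eq (F : Fml σ) (s t : Tm σ) :
    DerB σ Init (.ext s ::ₘ F.uniq t ::ₘ .eq s t ::ₘ Γ) (F.inst0 s ::ₘ Δ) := by
  refine lall _ _ ?_
  simpa [Fml.iff, Fml.inst0, Fml.inst, Tm.inst, Tm.inst_lift]
    using iff_mpr (Init := Init) (Γ := Γ) (Δ := Δ) (F.inst0 s) (.eq s t)

theorem eq_refl (t : Tm σ) : DerB σ Init Γ (.eq t t ::ₘ Δ) :=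
  eqE t (of_mem (A := .eq t t) (by simp) (by simp))

theorem eq_trans (r s t : Tm σ) : DerB σ Init (.eq s t ::ₘ .eq r s ::ₘ Γ) (.eq r t ::ₘ Δ) := by
  have h := eqI (Init := Init) (Γ := Γ) (Δ := .eq r t ::ₘ Δ) (.eq (r.lift 0) (.bvar 0)) s t trivial
  simp only [Fml.inst0, Fml.inst, Tm.inst, Tm.inst_lift, if_true] at h
  exact h (of_mem (A := .eq r t) (by simp) (by simp))

theorem eq_symm (s t : Tm σ) : DerB σ Init (.eq s t ::ₘ Γ) (.eq t s ::ₘ Δ) := by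
  refine eqE s ?_
  have h := eqI (Init := Init) (Γ := Γ) (Δ := .eq t s ::ₘ Δ) (.eq (.bvar 0) (s.lift 0)) s t trivial
  simp only [Fml.inst0, Fml.inst, Tm.inst, Tm.inst_lift, if_true] at h
  rw [Multiset.cons_swap]
  exact h (of_mem (A := .eq t s) (by simp) (by simp))

theorem eq_trans_symm (r s t : Tm σ) :
    DerB σ Init (.eq s t ::ₘ .eq r t ::ₘ Γ) (.eq s r ::ₘ Δ) := by
  refine cut_shared (A := .eq t r) ?_ ?_
  · rw [Multiset.cons_swap]
    exact eq_symm r t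
  · exact eq_trans s t r

/-- From `Γ ⇒ Δ, F[s/x]` and `Γ ⇒ Δ, ∃!s` one may add `s = t` to the antecedent in the
presence of `∀x(F ↔ x = t)`. -/
theorem cut_eq_of_uniq {F : Fml σ} {s t : Tm σ} (hu : F.uniq t ∈ Γ)
    (hF : DerB σ Init Γ (F.inst0 s ::ₘ Δ)) (hs : DerB σ Init Γ (.ext s ::ₘ Δ))
    (h : DerB σ Init (.eq s t ::ₘ Γ) Δ) : DerB σ Init Γ Δ := by
  obtain ⟨Γ, rfl⟩ := Multiset.exists_cons_of_mem hu
  refine cut_shared ?_ h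
  refine cut_shared (A := F.inst0 s) (hF.mono le_rfl ?_) ?_
  · exact Multiset.cons_le_cons _ (Multiset.le_cons_self _ _)
  refine cut_shared (A := .ext s) (hs.mono (Multiset.le_cons_self _ _) ?_) ?_
  · exact Multiset.cons_le_cons _ (Multiset.le_cons_self _ _)
  rw [Multiset.cons_swap (F.inst0 s)]
  exact eq_of_uniq F s t

theorem iq_exG_left {F : Fml σ} {a : ℕ} (hΓ : FreshM a Γ) (hΔ : FreshM a Δ) (hF : a ∉ F.pars)
    (h : DerB σ (Init7 σ) (.ext (.par a) ::ₘ F.uniq (.par a) ::ₘ Γ) Δ) :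
    DerB σ (Init7 σ) (.iq F Fml.exG ::ₘ Γ) Δ := by
  have hI : DerB σ (Init7 σ) {.iq F Fml.exG} {SI1L F Fml.exG} :=
    lc (Γ := 0) _ (initSeq ⟨F, rfl, rfl⟩)
  have hc := cut (Γ := {.iq F Fml.exG}) (Θ := 0) (Δ := Γ) (Λ := Δ) (SI1L F Fml.exG) hI
  simp only [Multiset.singleton_add, zero_add] at hc
  refine hc (lex _ a hΓ hΔ ?_ ?_)
  · simpa [Fml.pars, Fml.iff, Fml.exG, Tm.pars, Fml.pars_lift] using hF
  · rw [Multiset.cons_swap]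
    have hl := (land _ _ (h.mono (Multiset.cons_swap ..).le le_rfl)).lw (.ext (.par a))
    rw [Multiset.cons_swap]
    simpa [Fml.inst0, Fml.inst, Tm.inst, Tm.lift, Fml.inst_lift, Fml.iff, Fml.exG, Fml.uniq]
      using hl

end DerB

/-- **Theorem 1(c).**  In GPFL= (over the language extended with `I`)
augmented by the instances of (SI2) with `G` replaced by `∃!`, both the rule
(LI²') and the rule (LI³) are admissible. -/
theorem li2'_li3_admissible (σ : Sig) :
    (∀ (Γ Δ : Multiset (Fml σ)) (F : Fml σ) (t₁ t₂ : Tm σ),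
      DerB σ (Init7 σ) Γ ((F.inst0 t₁) ::ₘ Δ) →
      DerB σ (Init7 σ) Γ ((F.inst0 t₂) ::ₘ Δ) →
      DerB σ (Init7 σ) Γ ((Fml.ext t₁) ::ₘ Δ) →
      DerB σ (Init7 σ) Γ ((Fml.ext t₂) ::ₘ Δ) →
      DerB σ (Init7 σ) ((Fml.iq F Fml.exG) ::ₘ Γ) ((Fml.eq t₁ t₂) ::ₘ Δ))
    ∧
    (∀ (Γ Δ : Multiset (Fml σ)) (F : Fml σ) (a : ℕ),
      FreshM a Γ → FreshM a Δ → a ∉ F.pars →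
      DerB σ (Init7 σ) ((F.inst0 (.par a)) ::ₘ (Fml.ext (.par a)) ::ₘ Γ) Δ →
      DerB σ (Init7 σ) ((Fml.iq F Fml.exG) ::ₘ Γ) Δ) := by
  refine ⟨fun Γ Δ F t₁ t₂ hF₁ hF₂ h₁ h₂ => ?_, fun Γ Δ F a hΓ hΔ hF h => ?_⟩
  · obtain ⟨b, hb⟩ := (((((finite_setOf_not_freshM Γ).union (finite_setOf_not_freshM Δ)).union
      F.finite_pars).union t₁.finite_pars).union t₂.finite_pars).exists_notMem
    simp only [Set.mem_union, Set.mem_ofPred_eq, not_or, not_not] at hb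
    obtain ⟨⟨⟨⟨hΓ, hΔ⟩, hF⟩, hb₁⟩, hb₂⟩ := hb
    refine DerB.iq_exG_left hΓ (hΔ.cons (by simp [Fml.pars, hb₁, hb₂])) hF ?_
    have weaken {A : Fml σ} {Θ : Multiset (Fml σ)} (hΘ : Γ ≤ Θ)
        (h : DerB σ (Init7 σ) Γ (A ::ₘ Δ)) :
        DerB σ (Init7 σ) Θ (A ::ₘ .eq t₁ t₂ ::ₘ Δ) :=
      h.mono hΘ (Multiset.cons_le_cons _ (Multiset.le_cons_self _ _))
    have hΓ' : Γ ≤ .ext (.par b) ::ₘ F.uniq (.par b) ::ₘ Γ :=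
      (Multiset.le_cons_self _ _).trans (Multiset.le_cons_self _ _)
    have hΓ'' := hΓ'.trans (Multiset.le_cons_self _ (.eq t₂ (.par b)))
    refine DerB.cut_eq_of_uniq (F := F) (t := .par b) (by simp) (weaken hΓ' hF₂) (weaken hΓ' h₂) ?_
    refine DerB.cut_eq_of_uniq (F := F) (t := .par b) (by simp) (weaken hΓ'' hF₁) (weaken hΓ'' h₁) ?_
    exact DerB.eq_trans_symm t₂ t₁ (.par b)
  · refine DerB.iq_exG_left hΓ hΔ hF ?_
    refine DerB.cut_shared (A := F.inst0 (.par a)) ?_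
      (h.mono (Multiset.cons_le_cons _ (Multiset.cons_le_cons _ (Multiset.le_cons_self _ _))) le_rfl)
    refine DerB.eqE (.par a) ((DerB.of_uniq_of_eq (Γ := Γ) F (.par a) (.par a)).mono (le_of_eq ?_)
      le_rfl)
    simp only [← Multiset.singleton_add]
    abel
end

section
/- The rule (LI²') is admissible in GPFL=^I: whenever the four sequents Γ⇒Δ,F[t₁/x]; Γ⇒Δ,F[t₂/x]; Γ⇒Δ,∃!t₁; and Γ⇒Δ,∃!t₂ are provable in GPFL=^I, the sequent Ix[F,∃!x],Γ⇒Δ,t₁=t₂ is provable in GPFL=^I. -/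
/-- Proof trees of the sequent calculus GPFL=^I: Indrzejczak's calculus GPFL=
for classical positive free logic with identity, extended by Kürbis' rules
(RI), (LI¹), (LI²), (LI³), (LI⁴), (LI⁵) for the binary quantifier `I`.
Sequents relate finite multisets of formulas.  The parameter `P` constrains
the cut formulas: every cut formula of the proof must satisfy `P`
(so `P := fun _ => True` puts no constraint, and `P := fun _ => False` means
cut-free).  The last index is the height of the proof tree: the number of
nodes of its longest branch. -/
inductive Prf (σ : Sig) (P : Fml σ → Prop) :
    Multiset (Fml σ) → Multiset (Fml σ) → ℕ → Type
  | ax (A : Fml σ) : Prf σ P {A} {A} 1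
  | cut {Γ Θ Δ Λ : Multiset (Fml σ)} {m n : ℕ} (A : Fml σ) :
      Prf σ P Γ (A ::ₘ Θ) m → Prf σ P (A ::ₘ Δ) Λ n → P A →
      Prf σ P (Γ + Δ) (Θ + Λ) (max m n + 1)
  | lw {Γ Δ : Multiset (Fml σ)} {n : ℕ} (A : Fml σ) :
      Prf σ P Γ Δ n → Prf σ P (A ::ₘ Γ) Δ (n + 1)
  | rw {Γ Δ : Multiset (Fml σ)} {n : ℕ} (A : Fml σ) :
      Prf σ P Γ Δ n → Prf σ P Γ (A ::ₘ Δ) (n + 1)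
  | lc {Γ Δ : Multiset (Fml σ)} {n : ℕ} (A : Fml σ) :
      Prf σ P (A ::ₘ A ::ₘ Γ) Δ n → Prf σ P (A ::ₘ Γ) Δ (n + 1)
  | rc {Γ Δ : Multiset (Fml σ)} {n : ℕ} (A : Fml σ) :
      Prf σ P Γ (A ::ₘ A ::ₘ Δ) n → Prf σ P Γ (A ::ₘ Δ) (n + 1)
  | lneg {Γ Δ : Multiset (Fml σ)} {n : ℕ} (A : Fml σ) :
      Prf σ P Γ (A ::ₘ Δ) n → Prf σ P (A.neg ::ₘ Γ) Δ (n + 1)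
  | rneg {Γ Δ : Multiset (Fml σ)} {n : ℕ} (A : Fml σ) :
      Prf σ P (A ::ₘ Γ) Δ n → Prf σ P Γ (A.neg ::ₘ Δ) (n + 1)
  | land {Γ Δ : Multiset (Fml σ)} {n : ℕ} (A B : Fml σ) :
      Prf σ P (A ::ₘ B ::ₘ Γ) Δ n → Prf σ P ((A.conj B) ::ₘ Γ) Δ (n + 1)
  | rand {Γ Δ : Multiset (Fml σ)} {m n : ℕ} (A B : Fml σ) :
      Prf σ P Γ (A ::ₘ Δ) m → Prf σ P Γ (B ::ₘ Δ) n →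
      Prf σ P Γ ((A.conj B) ::ₘ Δ) (max m n + 1)
  | lor {Γ Δ : Multiset (Fml σ)} {m n : ℕ} (A B : Fml σ) :
      Prf σ P (A ::ₘ Γ) Δ m → Prf σ P (B ::ₘ Γ) Δ n →
      Prf σ P ((A.disj B) ::ₘ Γ) Δ (max m n + 1)
  | ror {Γ Δ : Multiset (Fml σ)} {n : ℕ} (A B : Fml σ) :
      Prf σ P Γ (A ::ₘ B ::ₘ Δ) n → Prf σ P Γ ((A.disj B) ::ₘ Δ) (n + 1)
  | limp {Γ Δ : Multiset (Fml σ)} {m n : ℕ} (A B : Fml σ) :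
      Prf σ P Γ (A ::ₘ Δ) m → Prf σ P (B ::ₘ Γ) Δ n →
      Prf σ P ((A.imp B) ::ₘ Γ) Δ (max m n + 1)
  | rimp {Γ Δ : Multiset (Fml σ)} {n : ℕ} (A B : Fml σ) :
      Prf σ P (A ::ₘ Γ) (B ::ₘ Δ) n → Prf σ P Γ ((A.imp B) ::ₘ Δ) (n + 1)
  | lall {Γ Δ : Multiset (Fml σ)} {n : ℕ} (A : Fml σ) (t : Tm σ) :
      Prf σ P ((A.inst0 t) ::ₘ Γ) Δ n →
      Prf σ P ((Fml.ext t) ::ₘ (Fml.all A) ::ₘ Γ) Δ (n + 1)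
  | rall {Γ Δ : Multiset (Fml σ)} {n : ℕ} (A : Fml σ) (a : ℕ) :
      FreshM a Γ → FreshM a Δ → a ∉ A.pars →
      Prf σ P ((Fml.ext (.par a)) ::ₘ Γ) ((A.inst0 (.par a)) ::ₘ Δ) n →
      Prf σ P Γ ((Fml.all A) ::ₘ Δ) (n + 1)
  | lex {Γ Δ : Multiset (Fml σ)} {n : ℕ} (A : Fml σ) (a : ℕ) :
      FreshM a Γ → FreshM a Δ → a ∉ A.pars →
      Prf σ P ((Fml.ext (.par a)) ::ₘ (A.inst0 (.par a)) ::ₘ Γ) Δ n →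
      Prf σ P ((Fml.ex A) ::ₘ Γ) Δ (n + 1)
  | rex {Γ Δ : Multiset (Fml σ)} {n : ℕ} (A : Fml σ) (t : Tm σ) :
      Prf σ P Γ ((A.inst0 t) ::ₘ Δ) n →
      Prf σ P ((Fml.ext t) ::ₘ Γ) ((Fml.ex A) ::ₘ Δ) (n + 1)
  | eqI {Γ Δ : Multiset (Fml σ)} {n : ℕ} (A : Fml σ) (t₁ t₂ : Tm σ) :
      A.Atomic →
      Prf σ P ((A.inst0 t₂) ::ₘ Γ) Δ n →
      Prf σ P ((Fml.eq t₁ t₂) ::ₘ (A.inst0 t₁) ::ₘ Γ) Δ (n + 1)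
  | eqE {Γ Δ : Multiset (Fml σ)} {n : ℕ} (t : Tm σ) :
      Prf σ P ((Fml.eq t t) ::ₘ Γ) Δ n → Prf σ P Γ Δ (n + 1)
  | ri {Γ Δ : Multiset (Fml σ)} {n₁ n₂ n₃ n₄ : ℕ} (F G : Fml σ) (t : Tm σ) (a : ℕ) :
      FreshM a Γ → FreshM a Δ → a ∉ F.pars → a ∉ G.pars →
      Prf σ P Γ ((F.inst0 t) ::ₘ Δ) n₁ →
      Prf σ P Γ ((G.inst0 t) ::ₘ Δ) n₂ →
      Prf σ P Γ ((Fml.ext t) ::ₘ Δ) n₃ →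
      Prf σ P ((Fml.ext (.par a)) ::ₘ (F.inst0 (.par a)) ::ₘ Γ)
        ((Fml.eq (.par a) t) ::ₘ Δ) n₄ →
      Prf σ P Γ ((Fml.iq F G) ::ₘ Δ) (max (max n₁ n₂) (max n₃ n₄) + 1)
  | li1 {Γ Δ : Multiset (Fml σ)} {n₁ n₂ n₃ n₄ : ℕ} (F G : Fml σ) (t : Tm σ) (a b : ℕ) :
      FreshM a Γ → FreshM a Δ → a ∉ F.pars → a ∉ G.pars →
      FreshM b Γ → FreshM b Δ → b ∉ F.pars → b ∉ G.pars →
      Prf σ P Γ ((F.inst0 t) ::ₘ Δ) n₁ →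
      Prf σ P Γ ((Fml.ext t) ::ₘ Δ) n₂ →
      Prf σ P ((F.inst0 (.par a)) ::ₘ (Fml.ext (.par a)) ::ₘ Γ)
        ((Fml.eq (.par a) t) ::ₘ Δ) n₃ →
      Prf σ P ((F.inst0 (.par b)) ::ₘ (G.inst0 (.par b)) ::ₘ (Fml.ext (.par b)) ::ₘ Γ) Δ n₄ →
      Prf σ P ((Fml.iq F G) ::ₘ Γ) Δ (max (max n₁ n₂) (max n₃ n₄) + 1)
  | li2 {Γ Δ : Multiset (Fml σ)} {n₁ n₂ n₃ n₄ n₅ : ℕ} (F A : Fml σ) (t₁ t₂ : Tm σ) :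
      A.Atomic →
      Prf σ P Γ ((F.inst0 t₁) ::ₘ Δ) n₁ →
      Prf σ P Γ ((F.inst0 t₂) ::ₘ Δ) n₂ →
      Prf σ P Γ ((Fml.ext t₁) ::ₘ Δ) n₃ →
      Prf σ P Γ ((Fml.ext t₂) ::ₘ Δ) n₄ →
      Prf σ P Γ ((A.inst0 t₂) ::ₘ Δ) n₅ →
      Prf σ P ((Fml.iq F Fml.exG) ::ₘ Γ) ((A.inst0 t₁) ::ₘ Δ)
        (max (max (max n₁ n₂) (max n₃ n₄)) n₅ + 1)
  | li3 {Γ Δ : Multiset (Fml σ)} {n : ℕ} (F : Fml σ) (a : ℕ) :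
      FreshM a Γ → FreshM a Δ → a ∉ F.pars →
      Prf σ P ((F.inst0 (.par a)) ::ₘ (Fml.ext (.par a)) ::ₘ Γ) Δ n →
      Prf σ P ((Fml.iq F Fml.exG) ::ₘ Γ) Δ (n + 1)
  | li4 {Γ Δ : Multiset (Fml σ)} {n₁ n₂ n₃ n₄ : ℕ} (F A : Fml σ) (t₁ t₂ : Tm σ) :
      A.Atomic →
      Prf σ P Γ ((F.inst0 t₁) ::ₘ Δ) n₁ →
      Prf σ P Γ ((Fml.ext t₁) ::ₘ Δ) n₂ →
      Prf σ P Γ ((Fml.ext t₂) ::ₘ Δ) n₃ →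
      Prf σ P Γ ((A.inst0 t₂) ::ₘ Δ) n₄ →
      Prf σ P ((Fml.iq F (Fml.eq (.bvar 0) (t₂.lift 0))) ::ₘ Γ) ((A.inst0 t₁) ::ₘ Δ)
        (max (max n₁ n₂) (max n₃ n₄) + 1)
  | li5 {Γ Δ : Multiset (Fml σ)} {m n : ℕ} (F : Fml σ) (t : Tm σ) (a : ℕ) :
      FreshM a Γ → FreshM a Δ → a ∉ F.pars → a ∉ t.pars →
      Prf σ P Γ ((Fml.ext t) ::ₘ Δ) m →
      Prf σ P ((F.inst0 (.par a)) ::ₘ (Fml.ext (.par a)) ::ₘ Γ) Δ n →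
      Prf σ P ((Fml.iq F (Fml.eq (.bvar 0) (t.lift 0))) ::ₘ Γ) Δ (max m n + 1)

/-- Provability in GPFL=^I (cuts unrestricted). -/
def Prov (σ : Sig) (Γ Δ : Multiset (Fml σ)) : Prop :=
  ∃ n, Nonempty (Prf σ (fun _ => True) Γ Δ n)

theorem Tm.inst_lift_self {σ : Sig} (u t : Tm σ) (k : ℕ) :
    Tm.inst k u (t.lift k) = t := by
  induction t with
  | par a => rfl
  | const c => rfl
  | bvar n =>
    by_cases h : n < k
    · simp [Tm.lift, Tm.inst, h, h.ne, h.not_gt]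
    · simp [Tm.lift, Tm.inst, h, show n + 1 ≠ k by omega, show k < n + 1 by omega]
  | func f ts ih => simp [Tm.lift, Tm.inst, ih]

namespace Prov

variable {σ : Sig} {Γ Δ : Multiset (Fml σ)}

theorem weaken_left (h : Prov σ Γ Δ) (A : Fml σ) : Prov σ (A ::ₘ Γ) Δ :=
  let ⟨_, ⟨p⟩⟩ := h
  ⟨_, ⟨.lw A p⟩⟩

theorem weaken_right (h : Prov σ Γ Δ) (A : Fml σ) : Prov σ Γ (A ::ₘ Δ) :=
  let ⟨_, ⟨p⟩⟩ := h
  ⟨_, ⟨.rw A p⟩⟩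

theorem eq_refl (t : Tm σ) (Γ Δ : Multiset (Fml σ)) : Prov σ Γ (Fml.eq t t ::ₘ Δ) := by
  induction Γ using Multiset.induction with
  | empty =>
    induction Δ using Multiset.induction with
    | empty => exact ⟨_, ⟨.eqE t (.ax (Fml.eq t t))⟩⟩
    | cons B Δ ih => exact Multiset.cons_swap B _ Δ ▸ ih.weaken_right B
  | cons B Γ ih => exact ih.weaken_left B

end Prov

/-- **Admissibility of (LI²') in GPFL=^I.**  Whenever the four sequents
`Γ ⇒ Δ, F[t₁/x]`; `Γ ⇒ Δ, F[t₂/x]`; `Γ ⇒ Δ, ∃!t₁`; and `Γ ⇒ Δ, ∃!t₂` are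
provable in GPFL=^I, the sequent `Ix[F,∃!x], Γ ⇒ Δ, t₁ = t₂` is provable
in GPFL=^I. -/
theorem li2'_admissible {σ : Sig} {Γ Δ : Multiset (Fml σ)}
    (F : Fml σ) (t₁ t₂ : Tm σ)
    (h₁ : Prov σ Γ ((F.inst0 t₁) ::ₘ Δ))
    (h₂ : Prov σ Γ ((F.inst0 t₂) ::ₘ Δ))
    (h₃ : Prov σ Γ ((Fml.ext t₁) ::ₘ Δ))
    (h₄ : Prov σ Γ ((Fml.ext t₂) ::ₘ Δ)) :
    Prov σ ((Fml.iq F Fml.exG) ::ₘ Γ) ((Fml.eq t₁ t₂) ::ₘ Δ) := by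
  obtain ⟨_, ⟨p₁⟩⟩ := h₁
  obtain ⟨_, ⟨p₂⟩⟩ := h₂
  obtain ⟨_, ⟨p₃⟩⟩ := h₃
  obtain ⟨_, ⟨p₄⟩⟩ := h₄
  have inst_eq (t : Tm σ) :
      (Fml.eq (.bvar 0) (t₂.lift 0)).inst0 t = Fml.eq t t₂ := by
    simp [Fml.inst0, Fml.inst, Tm.inst, Tm.inst_lift_self]
  have h₅ := Prov.eq_refl t₂ Γ Δ
  rw [← inst_eq] at h₅ ⊢
  obtain ⟨_, ⟨p₅⟩⟩ := h₅
  exact ⟨_, ⟨.li2 F _ t₁ t₂ trivial p₁ p₂ p₃ p₄ p₅⟩⟩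
end
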